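/- arXiv:2012.15517 — 2 statements merged into one kernel-verified Lean document; each statement's English description precedes it below -/
import Mathlib

section
/- Log-convexity with respect to the constraint values: let p_1,…,p_k ≥ 0 with ∑_{i=1}^k p_i = 1, let t^{(1)},…,t^{(k)} ∈ ℝ^r have all components strictly positive, and let t ∈ ℝ^r be defined by t_j = ∏_{i=1}^k (t^{(i)}_j)^{p_i} for every j. Then f(w,t,A) ≤ ∏_{i=1}^k f(w,t^{(i)},A)^{p_i}. -/
/-- A vector is admissible if it has positive components and satisfies
the log-linear constraints. -/
def Admissible (n r : ℕ) (A : Fin r → Fin n → ℝ) (t : Fin r → ℝ) (x : Fin n → ℝ) : Prop :=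
  (∀ i, 0 < x i) ∧ ∀ j, ∑ i, A j i * Real.log (x i) = Real.log (t j)

/-- The infimum of the linear objective over admissible vectors. -/
noncomputable def fval (n r : ℕ) (w : Fin n → ℝ) (A : Fin r → Fin n → ℝ)
    (t : Fin r → ℝ) : ℝ :=
  sInf {s | ∃ x : Fin n → ℝ, Admissible n r A t x ∧ s = ∑ i, w i * x i}

/-- A matrix over a field with linearly independent rows acts surjectively on vectors. -/
lemma mulVec_surjective_of_linearIndependent_row {K m n : Type*} [Field K] [Fintype m]
    [Fintype n] {M : Matrix m n K} (hM : LinearIndependent K M.row) :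
    Function.Surjective M.mulVec := by
  have h : LinearMap.range M.mulVecLin = ⊤ := by
    apply Submodule.eq_top_of_finrank_eq
    rw [Module.finrank_fintype_fun_eq_card]
    exact hM.rank_matrix
  exact LinearMap.range_eq_top.mp h

/-- **Hölder's inequality** for finitely many families with nonnegative entries and
positive sums. -/
lemma sum_prod_rpow_le_prod_sum_rpow {ι κ : Type*} [Fintype ι] [Fintype κ] (p : ι → ℝ)
    (hp : ∀ i, 0 ≤ p i) (hp1 : ∑ i, p i = 1) (a : ι → κ → ℝ) (ha : ∀ i m, 0 ≤ a i m)
    (hS : ∀ i, 0 < ∑ m, a i m) :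
    ∑ m, ∏ i, a i m ^ p i ≤ ∏ i, (∑ m, a i m) ^ p i := by
  have hP : 0 < ∏ i, (∑ m, a i m) ^ p i :=
    Finset.prod_pos fun i _ => Real.rpow_pos_of_pos (hS i) _
  rw [← div_le_one hP, Finset.sum_div]
  calc ∑ m, (∏ i, a i m ^ p i) / ∏ i, (∑ m, a i m) ^ p i
      = ∑ m, ∏ i, (a i m / ∑ m, a i m) ^ p i := by
        refine Finset.sum_congr rfl fun m _ => ?_
        rw [← Finset.prod_div_distrib]
        exact Finset.prod_congr rfl fun i _ => (Real.div_rpow (ha i m) (hS i).le _).symm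
    _ ≤ ∑ m, ∑ i, p i * (a i m / ∑ m, a i m) :=
        Finset.sum_le_sum fun m _ => Real.geom_mean_le_arith_mean_weighted _ _ _
          (fun i _ => hp i) hp1 fun i _ => div_nonneg (ha i m) (hS i).le
    _ = 1 := by
        rw [Finset.sum_comm, ← hp1]
        refine Finset.sum_congr rfl fun i _ => ?_
        rw [← Finset.mul_sum, ← Finset.sum_div, div_self (hS i).ne', mul_one]

/-- Linear independence of the constraints makes the admissible set nonempty. -/
lemma exists_admissible {n r : ℕ} {A : Fin r → Fin n → ℝ} (hA : LinearIndependent ℝ A)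
    (t : Fin r → ℝ) : ∃ x, Admissible n r A t x := by
  obtain ⟨y, hy⟩ := mulVec_surjective_of_linearIndependent_row (M := Matrix.of A) hA
    fun j => Real.log (t j)
  refine ⟨fun i => Real.exp (y i), fun i => Real.exp_pos _, fun j => ?_⟩
  simpa [Matrix.mulVec, dotProduct] using congrFun hy j

/-- Weighted geometric means of admissible vectors are admissible for the weighted geometric
mean of the constraint values. -/
lemma Admissible.prod_rpow {n r : ℕ} {A : Fin r → Fin n → ℝ} {ι : Type*} [Fintype ι]
    (p : ι → ℝ) {t : ι → Fin r → ℝ} (ht : ∀ i j, 0 < t i j) {x : ι → Fin n → ℝ}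
    (hx : ∀ i, Admissible n r A (t i) (x i)) :
    Admissible n r A (fun j => ∏ i, t i j ^ p i) (fun m => ∏ i, x i m ^ p i) := by
  have hlog : ∀ y : ι → ℝ, (∀ i, 0 < y i) →
      Real.log (∏ i, y i ^ p i) = ∑ i, p i * Real.log (y i) := fun y hy => by
    rw [Real.log_prod fun i _ => (Real.rpow_pos_of_pos (hy i) _).ne']
    exact Finset.sum_congr rfl fun i _ => Real.log_rpow (hy i) _
  refine ⟨fun m => Finset.prod_pos fun i _ => Real.rpow_pos_of_pos ((hx i).1 m) _,
    fun j => ?_⟩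
  rw [hlog _ fun i => ht i j]
  simp_rw [hlog _ fun i => (hx i).1 _, ← (hx _).2 j, Finset.mul_sum]
  rw [Finset.sum_comm]
  exact Finset.sum_congr rfl fun i _ => Finset.sum_congr rfl fun m _ => by ring

lemma fval_le_of_admissible {n r : ℕ} {w : Fin n → ℝ} (hw : ∀ i, 0 < w i)
    {A : Fin r → Fin n → ℝ} {t : Fin r → ℝ} {x : Fin n → ℝ} (hx : Admissible n r A t x) :
    fval n r w A t ≤ ∑ i, w i * x i := by
  refine csInf_le ⟨0, ?_⟩ ⟨x, hx, rfl⟩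
  rintro _ ⟨y, hy, rfl⟩
  exact Finset.sum_nonneg fun i _ => mul_nonneg (hw i).le (hy.1 i).le

lemma exists_admissible_lt_of_fval_lt {n r : ℕ} {w : Fin n → ℝ} {A : Fin r → Fin n → ℝ}
    (hA : LinearIndependent ℝ A) {t : Fin r → ℝ} {b : ℝ} (hb : fval n r w A t < b) :
    ∃ x, Admissible n r A t x ∧ ∑ i, w i * x i < b := by
  obtain ⟨y, hy⟩ := exists_admissible hA t
  have hne : {s | ∃ x, Admissible n r A t x ∧ s = ∑ i, w i * x i}.Nonempty :=
    ⟨_, y, hy, rfl⟩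
  obtain ⟨_, ⟨x, hx, rfl⟩, hlt⟩ := exists_lt_of_csInf_lt hne hb
  exact ⟨x, hx, hlt⟩

/-- Log-convexity of `f(w,t,A)` with respect to the constraint values `t`. -/
theorem fval_log_convex_in_t
    (n r : ℕ) (hn : 1 ≤ n) (hr : 1 ≤ r)
    (w : Fin n → ℝ) (hw : ∀ i, 0 < w i)
    (A : Fin r → Fin n → ℝ) (hA : LinearIndependent ℝ A)
    (k : ℕ) (p : Fin k → ℝ) (hp : ∀ i, 0 ≤ p i) (hp1 : ∑ i, p i = 1)
    (tt : Fin k → Fin r → ℝ) (htt : ∀ i j, 0 < tt i j)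
    (t : Fin r → ℝ) (htdef : ∀ j, t j = ∏ i, (tt i j) ^ (p i)) :
    fval n r w A t ≤ ∏ i, (fval n r w A (tt i)) ^ (p i) := by
  obtain rfl : t = fun j => ∏ i, tt i j ^ p i := funext htdef
  have key : ∀ ε > 0, fval n r w A (fun j => ∏ i, tt i j ^ p i) ≤
      ∏ i, (fval n r w A (tt i) + ε) ^ p i := by
    intro ε hε
    choose x hx hlt using fun i =>
      exists_admissible_lt_of_fval_lt hA (lt_add_of_pos_right (fval n r w A (tt i)) hε)
    have hwx : ∀ i m, 0 < w m * x i m := fun i m => mul_pos (hw m) ((hx i).1 m)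
    have hS : ∀ i, 0 < ∑ m, w m * x i m := fun i =>
      Finset.sum_pos (fun m _ => hwx i m) ⟨⟨0, hn⟩, Finset.mem_univ _⟩
    calc fval n r w A (fun j => ∏ i, tt i j ^ p i)
        ≤ ∑ m, w m * ∏ i, x i m ^ p i :=
          fval_le_of_admissible hw (Admissible.prod_rpow p htt hx)
      _ = ∑ m, ∏ i, (w m * x i m) ^ p i := by
          refine Finset.sum_congr rfl fun m _ => ?_
          simp_rw [Real.mul_rpow (hw m).le ((hx _).1 m).le]
          rw [Finset.prod_mul_distrib, ← Real.rpow_sum_of_pos (hw m), hp1, Real.rpow_one]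
      _ ≤ ∏ i, (∑ m, w m * x i m) ^ p i :=
          sum_prod_rpow_le_prod_sum_rpow p hp hp1 _ (fun i m => (hwx i m).le) hS
      _ ≤ ∏ i, (fval n r w A (tt i) + ε) ^ p i :=
          Finset.prod_le_prod (fun i _ => Real.rpow_nonneg (hS i).le _) fun i _ =>
            Real.rpow_le_rpow (hS i).le (hlt i).le (hp i)
  have hcont : Continuous fun ε : ℝ => ∏ i, (fval n r w A (tt i) + ε) ^ p i :=
    continuous_finsetProd _ fun i _ =>
      (continuous_const.add continuous_id).rpow_const fun _ => Or.inr (hp i)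
  have hlim : Filter.Tendsto (fun ε : ℝ => ∏ i, (fval n r w A (tt i) + ε) ^ p i)
      (nhdsWithin 0 (Set.Ioi 0)) (nhds (∏ i, fval n r w A (tt i) ^ p i)) := by
    simpa using (hcont.tendsto 0).mono_left nhdsWithin_le_nhds
  exact ge_of_tendsto hlim (Filter.eventually_of_mem self_mem_nhdsWithin key)
end

section
/- Lower bound for f_Γ in terms of the numbers of arcs and vertices: let Γ = (𝒱, 𝒜, α, β) be a strongly connected finite directed multigraph with n = |𝒱| vertices and m = |𝒜| arcs. If n = m then f_Γ = m. If 1 ≤ n ≤ m − 1, then f_Γ ≥ e · m · λ · (m − n + 1)^{−λ} · ln(m − n + 1), where λ = 1 + 1/(m − n). -/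
/-- A positive arc-value function has unit cycle products if its product over
every closed walk equals `1`. -/
def UnitCycleProducts {V A : Type*} [Fintype A] (α β : A → V) (x : A → ℝ) : Prop :=
  ∀ (k : ℕ) (a : Fin (k + 1) → A),
    (∀ i : Fin k, β (a i.castSucc) = α (a i.succ)) →
    β (a (Fin.last k)) = α (a 0) →
    ∏ i, x (a i) = 1

/-- Strong connectivity of a directed multigraph given by `α, β : A → V`. -/
def StronglyConnected {V A : Type*} (α β : A → V) : Prop :=
  ∀ u v : V, u ≠ v → ∃ (k : ℕ) (a : Fin (k + 1) → A),
    α (a 0) = u ∧ β (a (Fin.last k)) = v ∧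
    ∀ i : Fin k, β (a i.castSucc) = α (a i.succ)

/-- The minimum total of arc values subject to unit cycle products. -/
noncomputable def fGamma {V A : Type*} [Fintype A] (α β : A → V) : ℝ :=
  sInf {s | ∃ x : A → ℝ, ((∀ a, 0 < x a) ∧ UnitCycleProducts α β x) ∧
    s = ∑ a : A, x a}

/-- `IsArcWalk α β u l v` says that the arcs in `l` form a walk from `u` to `v`. -/
def IsArcWalk {V A : Type*} (α β : A → V) : V → List A → V → Prop
  | u, [], v => u = v
  | u, a :: l, v => α a = u ∧ IsArcWalk α β (β a) l v

section Walks

variable {V A : Type*} {α β : A → V}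

theorem isArcWalk_append {u v : V} {l₁ l₂ : List A} :
    IsArcWalk α β u (l₁ ++ l₂) v ↔ ∃ w, IsArcWalk α β u l₁ w ∧ IsArcWalk α β w l₂ v := by
  induction l₁ generalizing u with
  | nil => simp [IsArcWalk]
  | cons a l ih => simp [IsArcWalk, ih, and_assoc]

theorem isArcWalk_ofFn {k : ℕ} {a : Fin (k + 1) → A}
    (h : ∀ i : Fin k, β (a i.castSucc) = α (a i.succ)) :
    IsArcWalk α β (α (a 0)) (List.ofFn a) (β (a (Fin.last k))) := by
  induction k with
  | zero => simp [IsArcWalk]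
  | succ k ih =>
    rw [List.ofFn_succ]
    refine ⟨rfl, ?_⟩
    have h₀ := h 0
    simp only [Fin.castSucc_zero] at h₀
    rw [h₀]
    exact ih (a := fun i => a i.succ) fun i => h i.succ

theorem IsArcWalk.exists_ofFn {u v : V} {b : A} {l : List A}
    (h : IsArcWalk α β u (b :: l) v) :
    ∃ (k : ℕ) (a : Fin (k + 1) → A), List.ofFn a = b :: l ∧ α (a 0) = u ∧
      β (a (Fin.last k)) = v ∧ ∀ i : Fin k, β (a i.castSucc) = α (a i.succ) := by
  induction l generalizing u b with
  | nil => exact ⟨0, fun _ => b, by simp, h.1, h.2, fun i => i.elim0⟩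
  | cons c l ih =>
    obtain ⟨k, a, ha, h₀, h₁, h₂⟩ := ih h.2
    refine ⟨k + 1, Fin.cons b a, by rw [List.ofFn_succ]; simpa using ha, h.1, ?_, ?_⟩
    · rw [← Fin.succ_last, Fin.cons_succ, h₁]
    · intro i
      refine Fin.cases ?_ (fun j => ?_) i
      · simpa using h₀.symm
      · simpa [← Fin.succ_castSucc] using h₂ j

theorem StronglyConnected.exists_isArcWalk (hsc : StronglyConnected α β) (u v : V) :
    ∃ l, IsArcWalk α β u l v := by
  by_cases huv : u = v
  · exact ⟨[], huv⟩
  · obtain ⟨k, a, rfl, rfl, h⟩ := hsc u v huv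
    exact ⟨_, isArcWalk_ofFn h⟩

/-- Every arc lies on a closed walk without repeated arcs. -/
theorem StronglyConnected.exists_nodup_closed (hsc : StronglyConnected α β) (a : A) :
    ∃ l, (a :: l).Nodup ∧ IsArcWalk α β (α a) (a :: l) (α a) := by
  classical
  obtain ⟨l, hl, hmin⟩ := WellFounded.has_min (measure (List.length (α := A))).wf
    {l | IsArcWalk α β (β a) l (α a)} (hsc.exists_isArcWalk _ _)
  simp only [Set.mem_ofPred_eq, InvImage, not_lt,
    WellFoundedRelation.rel] at hl hmin
  refine ⟨l, ?_, rfl, hl⟩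
  rw [List.nodup_cons]
  constructor
  · intro ha
    obtain ⟨l₁, l₂, rfl⟩ := List.append_of_mem ha
    obtain ⟨w, hw, rfl, -⟩ := isArcWalk_append.1 hl
    have := hmin l₁ hw
    simp at this
  · by_contra hdup
    rw [← List.exists_duplicate_iff_not_nodup] at hdup
    obtain ⟨b, hb⟩ := hdup
    rw [List.duplicate_iff_two_le_count] at hb
    obtain ⟨l₁, l₂, rfl⟩ := List.append_of_mem (List.count_pos_iff.1 (by omega : 0 < l.count b))
    obtain ⟨w, hw, rfl, h₂⟩ := isArcWalk_append.1 hl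
    by_cases hb₁ : b ∈ l₁
    · obtain ⟨l₃, l₄, rfl⟩ := List.append_of_mem hb₁
      obtain ⟨w', hw', rfl, -⟩ := isArcWalk_append.1 hw
      have := hmin (l₃ ++ b :: l₂) (isArcWalk_append.2 ⟨_, hw', rfl, h₂⟩)
      simp at this
      omega
    · have hb₂ : b ∈ l₂ := by
        rw [List.count_append, List.count_eq_zero_of_not_mem hb₁, List.count_cons_self] at hb
        exact List.count_pos_iff.1 (by omega)
      obtain ⟨l₃, l₄, rfl⟩ := List.append_of_mem hb₂
      obtain ⟨w', hw', rfl, h₄⟩ := isArcWalk_append.1 h₂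
      have := hmin (l₁ ++ b :: l₄) (isArcWalk_append.2 ⟨_, hw, rfl, h₄⟩)
      simp at this
      omega

theorem IsArcWalk.sum_potential {u v : V} {l : List A} (h : IsArcWalk α β u l v) (q : V → ℝ) :
    (l.map fun b => q (β b) - q (α b)).sum = q v - q u := by
  induction l generalizing u with
  | nil => simp [show u = v from h]
  | cons a l ih =>
    obtain ⟨rfl, h⟩ := h
    simp [ih h]

theorem UnitCycleProducts.sum_log [Fintype A] {x : A → ℝ} (hx : UnitCycleProducts α β x)
    (hpos : ∀ a, 0 < x a) {u : V} {b : A} {l : List A} (h : IsArcWalk α β u (b :: l) u) :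
    ((b :: l).map fun b => Real.log (x b)).sum = 0 := by
  obtain ⟨k, a, ha, h₀, h₁, h₂⟩ := h.exists_ofFn
  have := hx k a h₂ (h₁.trans h₀.symm)
  rw [← ha, List.map_ofFn, List.sum_ofFn]
  simp only [Function.comp_apply]
  rw [← Real.log_prod fun i _ => (hpos _).ne', this, Real.log_one]

theorem List.Nodup.sum_map_eq_sum_indicator [Fintype A] [DecidableEq A] {l : List A}
    (hl : l.Nodup) (f : A → ℝ) :
    (l.map f).sum = ∑ b, (if b ∈ l then 1 else 0) * f b := by
  rw [← List.sum_toFinset f hl]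
  simp [← List.mem_toFinset]

end Walks

section CycleSpace

variable {V A : Type*} [Fintype V] [Fintype A]

/-- The coboundary map sending a potential on the vertices to its differences along the arcs. -/
def arcCoboundary (α β : A → V) : (V → ℝ) →ₗ[ℝ] (A → ℝ) :=
  LinearMap.funLeft ℝ ℝ β - LinearMap.funLeft ℝ ℝ α

/-- The circulations, as the arc functions orthogonal to all coboundaries. -/
def cycleSpace (α β : A → V) : Submodule ℝ (A → ℝ) where
  carrier := {c | ∀ q : V → ℝ, ∑ b, c b * (q (β b) - q (α b)) = 0}
  add_mem' hc hd q := by simp [add_mul, Finset.sum_add_distrib, hc q, hd q]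
  zero_mem' q := by simp
  smul_mem' r c hc q := by simp [mul_assoc, ← Finset.mul_sum, hc q]

theorem StronglyConnected.finrank_cycleSpace_le {α β : A → V} (hsc : StronglyConnected α β) :
    Module.finrank ℝ (cycleSpace α β) + Fintype.card V ≤ Fintype.card A + 1 := by
  have hdisj : Disjoint (cycleSpace α β) (LinearMap.range (arcCoboundary α β)) := by
    rw [Submodule.disjoint_def]
    rintro c hc ⟨q, rfl⟩
    have h := hc q
    ext b
    exact mul_self_eq_zero.1
      ((Finset.sum_eq_zero_iff_of_nonneg fun _ _ => mul_self_nonneg _).1 h b (Finset.mem_univ b))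
  have h₁ := Submodule.finrank_add_finrank_le_of_disjoint hdisj
  have h₂ := LinearMap.finrank_range_add_finrank_ker (arcCoboundary α β)
  have hker : LinearMap.ker (arcCoboundary α β) ≤ Submodule.span ℝ {fun _ => (1 : ℝ)} := by
    intro q hq
    have hq' : ∀ b, q (β b) - q (α b) = 0 := fun b => congrFun hq b
    have hconst : ∀ u v, q v = q u := fun u v => by
      obtain ⟨l, hl⟩ := hsc.exists_isArcWalk u v
      have := hl.sum_potential q
      simp only [hq', List.map_const', List.sum_replicate, smul_zero] at this
      linarith
    rw [Submodule.mem_span_singleton]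
    rcases isEmpty_or_nonempty V with hV | ⟨⟨u⟩⟩
    · exact ⟨0, Subsingleton.elim _ _⟩
    · exact ⟨q u, by ext v; simp [hconst u v]⟩
  have h₃ := (Submodule.finrank_mono hker).trans (finrank_span_le_card _)
  rw [Set.toFinset_singleton, Finset.card_singleton] at h₃
  rw [Module.finrank_fintype_fun_eq_card] at h₁ h₂
  omega

/-- A minimal subfamily covering all coordinates is linearly independent. -/
theorem exists_linearIndependent_cover {ι κ : Type*} [Finite κ] (c : κ → ι → ℝ)
    (hc : ∀ b, ∃ a, c a b ≠ 0) :
    ∃ T : Finset κ, (∀ b, ∃ a ∈ T, c a b ≠ 0) ∧ LinearIndependent ℝ fun a : T => c a := by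
  classical
  have := Fintype.ofFinite κ
  obtain ⟨T, hT⟩ := exists_minimal_of_wellFoundedLT
    (fun T : Finset κ => ∀ b, ∃ a ∈ T, c a b ≠ 0) ⟨Finset.univ, by simpa using hc⟩
  refine ⟨T, hT.prop, Fintype.linearIndependent_iff.2 fun g hg a => ?_⟩
  have hnot := hT.not_prop_of_lt (Finset.erase_ssubset a.2)
  push Not at hnot
  obtain ⟨b, hb⟩ := hnot
  have hother : ∀ a' : T, a' ≠ a → c a' b = 0 := fun a' h =>
    hb a' (Finset.mem_erase.2 ⟨fun h' => h (Subtype.ext h'), a'.2⟩)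
  have hab : c a b ≠ 0 := by
    obtain ⟨a', ha', h⟩ := hT.prop b
    by_cases he : (⟨a', ha'⟩ : T) = a
    · rwa [← he]
    · exact absurd (hother _ he) h
  have hsum := congrFun hg b
  rw [Finset.sum_apply, Finset.sum_eq_single a (fun a' _ h => by simp [hother a' h])
    (by simp)] at hsum
  simpa [hab] using hsum

/-- There are weights in `[1, m - n + 1]` orthogonal to the logarithm of every arc function
with unit cycle products. -/
theorem StronglyConnected.exists_weights {α β : A → V} (hsc : StronglyConnected α β) :
    ∃ w : A → ℝ, (∀ b, 1 ≤ w b ∧ w b ≤ (Fintype.card A : ℝ) - Fintype.card V + 1) ∧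
      ∀ x : A → ℝ, (∀ a, 0 < x a) → UnitCycleProducts α β x →
        ∑ b, w b * Real.log (x b) = 0 := by
  classical
  choose l hnodup hwalk using hsc.exists_nodup_closed
  set c : A → A → ℝ := fun a b => if b ∈ a :: l a then 1 else 0 with hcdef
  have hmem : ∀ a, c a ∈ cycleSpace α β := fun a q => by
    rw [hcdef, ← (hnodup a).sum_map_eq_sum_indicator fun b => q (β b) - q (α b),
      (hwalk a).sum_potential, sub_self]
  have hc₀ : ∀ a b, 0 ≤ c a b := fun a b => by simp only [hcdef]; split_ifs <;> simp
  have hc₁ : ∀ a b, c a b ≤ 1 := fun a b => by simp only [hcdef]; split_ifs <;> simp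
  obtain ⟨T, hcover, hli⟩ := exists_linearIndependent_cover c fun b => ⟨b, by simp [hcdef]⟩
  have hT : T.card ≤ Module.finrank ℝ (cycleSpace α β) := by
    have hli' : LinearIndependent ℝ fun a : T => (⟨c a, hmem a⟩ : cycleSpace α β) :=
      LinearIndependent.of_comp (cycleSpace α β).subtype hli
    simpa using hli'.fintype_card_le_finrank
  have hTle : (T.card : ℝ) ≤ (Fintype.card A : ℝ) - Fintype.card V + 1 := by
    have : (T.card : ℝ) + Fintype.card V ≤ Fintype.card A + 1 := by
      exact_mod_cast (Nat.add_le_add_right hT _).trans hsc.finrank_cycleSpace_le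
    linarith
  refine ⟨fun b => ∑ a ∈ T, c a b, fun b => ⟨?_, ?_⟩, fun x hpos hx => ?_⟩
  · obtain ⟨a, ha, hab⟩ := hcover b
    have : c a b = 1 := by
      simp only [hcdef] at hab ⊢
      split_ifs at hab ⊢ <;> simp_all
    rw [← this]
    exact Finset.single_le_sum (f := fun a => c a b) (fun a _ => hc₀ a b) ha
  · refine le_trans ?_ hTle
    simpa using Finset.sum_le_card_nsmul T (fun a => c a b) 1 fun a _ => hc₁ a b
  · simp only [Finset.sum_mul]
    rw [Finset.sum_comm]
    refine Finset.sum_eq_zero fun a _ => ?_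
    rw [hcdef, ← (hnodup a).sum_map_eq_sum_indicator fun b => Real.log (x b)]
    exact hx.sum_log hpos (hwalk a)

end CycleSpace

/-- The chord bound for `w ↦ w * log w` on `[1, k]`. -/
theorem Real.mul_log_le_chord {d w : ℝ} (hd : 0 < d) (h₁ : 1 ≤ w) (h₂ : w ≤ d + 1) :
    w * Real.log w ≤ (1 + 1 / d) * Real.log (d + 1) * (w - 1) := by
  have h := Real.convexOn_mul_log.2 (Set.mem_Ici.2 zero_le_one)
    (Set.mem_Ici.2 (by linarith : 0 ≤ d + 1))
    (div_nonneg (by linarith) hd.le : 0 ≤ (d + 1 - w) / d)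
    (div_nonneg (by linarith) hd.le : 0 ≤ (w - 1) / d) (by field_simp; ring)
  simp only [smul_eq_mul, Real.log_one, mul_zero, zero_add] at h
  have hw : (d + 1 - w) / d * 1 + (w - 1) / d * (d + 1) = w := by field_simp; ring
  rw [hw] at h
  refine h.trans_eq ?_
  field_simp

/-- Weighted tangent-line lower bound for a sum of positive reals. -/
theorem card_mul_exp_le_sum {A : Type*} [Fintype A] {w x : A → ℝ} {C : ℝ}
    (hw : ∀ b, 0 < w b) (hC : ∀ b, w b * Real.log (w b) ≤ C * (w b - 1))
    (hx : ∀ b, 0 < x b) (hsum : ∑ b, w b * Real.log (x b) = 0) :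
    Fintype.card A * (C * Real.exp (1 - C)) ≤ ∑ b, x b := by
  have key : ∀ b, Real.exp (1 - C) * (C + w b * Real.log (x b)) ≤ x b := fun b => by
    have hwe : 0 < w b * Real.exp (1 - C) := mul_pos (hw b) (Real.exp_pos _)
    have h := Real.log_le_sub_one_of_pos (div_pos (hx b) hwe)
    rw [Real.log_div (hx b).ne' hwe.ne', Real.log_mul (hw b).ne' (Real.exp_pos _).ne',
      Real.log_exp, le_sub_iff_add_le, le_div_iff₀ hwe] at h
    nlinarith [mul_le_mul_of_nonneg_left (hC b) (Real.exp_pos (1 - C)).le]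
  calc Fintype.card A * (C * Real.exp (1 - C))
      = ∑ b, Real.exp (1 - C) * (C + w b * Real.log (x b)) := by
        rw [← Finset.mul_sum, Finset.sum_add_distrib, hsum]
        simp
        ring
    _ ≤ ∑ b, x b := Finset.sum_le_sum fun b _ => key b

theorem le_fGamma {V A : Type*} [Fintype A] {α β : A → V} {r : ℝ}
    (h : ∀ x : A → ℝ, (∀ a, 0 < x a) → UnitCycleProducts α β x → r ≤ ∑ a, x a) :
    r ≤ fGamma α β := by
  refine le_csInf ⟨_, fun _ => 1, ⟨fun _ => one_pos, fun _ _ _ _ => by simp⟩, rfl⟩ ?_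
  rintro _ ⟨x, ⟨hpos, hx⟩, rfl⟩
  exact h x hpos hx

theorem fGamma_le_card {V A : Type*} [Fintype A] (α β : A → V) :
    fGamma α β ≤ Fintype.card A := by
  refine csInf_le ⟨0, ?_⟩ ⟨fun _ => 1, ⟨fun _ => one_pos, fun _ _ _ _ => by simp⟩, by simp⟩
  rintro _ ⟨x, ⟨hpos, -⟩, rfl⟩
  exact Finset.sum_nonneg fun a _ => (hpos a).le

/-- Lower bound for `f_Γ` in terms of the numbers `n` of vertices and `m` of
arcs: if `n = m` then `f_Γ = m`; if `1 ≤ n ≤ m - 1` then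
`f_Γ ≥ e·m·λ·(m-n+1)^(-λ)·ln(m-n+1)` where `λ = 1 + 1/(m-n)`. -/
theorem fGamma_lower_bound
    {V A : Type*} [Fintype V] [Fintype A] (α β : A → V)
    (hsc : StronglyConnected α β) :
    (Fintype.card V = Fintype.card A → fGamma α β = (Fintype.card A : ℝ)) ∧
    (1 ≤ Fintype.card V →
      (Fintype.card V : ℝ) ≤ (Fintype.card A : ℝ) - 1 →
      fGamma α β ≥
        Real.exp 1 * (Fintype.card A : ℝ) *
          (1 + 1 / ((Fintype.card A : ℝ) - (Fintype.card V : ℝ))) *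
          ((Fintype.card A : ℝ) - (Fintype.card V : ℝ) + 1) ^
            (-(1 + 1 / ((Fintype.card A : ℝ) - (Fintype.card V : ℝ)))) *
          Real.log ((Fintype.card A : ℝ) - (Fintype.card V : ℝ) + 1)) := by
  obtain ⟨w, hw, hlog⟩ := hsc.exists_weights
  have hwpos : ∀ b, 0 < w b := fun b => one_pos.trans_le (hw b).1
  refine ⟨fun hcard => (fGamma_le_card α β).antisymm (le_fGamma fun x hpos hx => ?_),
    fun _ hcard => le_fGamma fun x hpos hx => ?_⟩
  · have hw₁ : ∀ b, w b = 1 := fun b => le_antisymm (by simpa [hcard] using (hw b).2) (hw b).1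
    simpa using card_mul_exp_le_sum (C := 1) hwpos (by simp [hw₁]) hpos (hlog x hpos hx)
  · set d := (Fintype.card A : ℝ) - Fintype.card V with hd
    have hdpos : 0 < d := by linarith
    refine le_of_eq_of_le ?_ (card_mul_exp_le_sum hwpos
      (fun b => Real.mul_log_le_chord hdpos (hw b).1 (hw b).2) hpos (hlog x hpos hx))
    rw [Real.rpow_def_of_pos (by linarith), sub_eq_add_neg, Real.exp_add,
      show Real.log (d + 1) * -(1 + 1 / d) = -((1 + 1 / d) * Real.log (d + 1)) by ring]
    ring
end
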